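/- Suppose every n-node s-parallel-greedy graph has arboricity at most α(n,s). Fix h ≥ 1, s ≥ 2, a graph G with edge lengths and capacities, and node-weighting A. If (C_1, C_2, ...) is a sequence of length-constrained cuts, then C = (1 + 1/(s−1))·Σ_i C_i is a (2h, (s−1)/2)-length φ'-sparse cut with respect to A, where φ' = 8·α(|A|, s)·(Σ_i |C_i|) / (Σ_i A_{(h,s)}(C_i)), and A_{(h,s)}(C_i) denotes the demand-size of C_i in G − (Σ_{j<i} C_j)_{hs}. -/

import Mathlib

open SimpleGraph Finset

variable {V : Type*}

/-- The length of a walk with respect to the edge length function `ℓ`. -/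
def walkLen {G : SimpleGraph V} (ℓ : Sym2 V → ℝ) {u v : V} (p : G.Walk u v) : ℝ :=
  (p.edges.map ℓ).sum

/-- A demand `D` is `A`-respecting if every vertex sends and receives at most `A v`. -/
def Respecting [Fintype V] (A : V → ℕ) (D : V → V → ℕ) : Prop :=
  ∀ v, (∑ w, D v w) ≤ A v ∧ (∑ w, D w v) ≤ A v

/-- A demand `D` is `h`-length (w.r.t. edge lengths `ℓ`) if positive demand pairs are at
distance at most `h`, i.e. joined by a walk of length at most `h`. -/
def HLength (G : SimpleGraph V) (ℓ : Sym2 V → ℝ) (h : ℝ) (D : V → V → ℕ) : Prop :=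
  ∀ u v, 0 < D u v → ∃ p : G.Walk u v, walkLen ℓ p ≤ h

/-- `u` and `v` are at distance strictly greater than `h` w.r.t. edge lengths `ℓ`. -/
def FarApart (G : SimpleGraph V) (ℓ : Sym2 V → ℝ) (h : ℝ) (u v : V) : Prop :=
  ∀ p : G.Walk u v, h < walkLen ℓ p

/-- The demand `D` is `hs`-separated by the cut `C` (applied at scale `hs` to the edge
lengths `ℓ`): every positive demand pair is at distance `> hs` in `G − C_{hs}`. -/
def SeparatedDemand (G : SimpleGraph V) (ℓ : Sym2 V → ℝ) (hs : ℝ) (C : Sym2 V → ℝ)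
    (D : V → V → ℕ) : Prop :=
  ∀ u v, 0 < D u v → FarApart G (fun e => ℓ e + hs * C e) hs u v

/-- The size `|C| = Σ_e U_e·C(e)` of a length-constrained cut `C`, with capacities `cap`. -/
noncomputable def cutSize [Fintype V] [DecidableEq V] (G : SimpleGraph V)
    [DecidableRel G.Adj] (cap : Sym2 V → ℕ) (C : Sym2 V → ℝ) : ℝ :=
  ∑ e ∈ G.edgeFinset, (cap e : ℝ) * C e

/-- The `(h,s)`-length demand-size of the cut `C` w.r.t. the node-weighting `A`, in the
graph `G` with edge lengths `ℓ`: the maximum size of an `A`-respecting `h`-length demand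
which is `hs`-separated by `C`. -/
noncomputable def demandSize [Fintype V] (G : SimpleGraph V) (ℓ : Sym2 V → ℝ)
    (A : V → ℕ) (C : Sym2 V → ℝ) (h hs : ℝ) : ℕ :=
  sSup {n | ∃ D : V → V → ℕ, Respecting A D ∧ HLength G ℓ h D ∧
    SeparatedDemand G ℓ hs C D ∧ n = ∑ u, ∑ v, D u v}

/-- `M` witnesses that `G` is `s`-parallel-greedy. -/
def IsParallelGreedy {W : Type*} (G : SimpleGraph W) (s k : ℕ)
    (M : Fin k → SimpleGraph W) : Prop :=
  (∀ i, M i ≤ G) ∧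
  (∀ e ∈ G.edgeSet, ∃ i, e ∈ (M i).edgeSet) ∧
  (Pairwise fun i j => Disjoint (M i).edgeSet (M j).edgeSet) ∧
  (∀ i, ∀ v u w : W, (M i).Adj v u → (M i).Adj v w → u = w) ∧
  (∀ i : Fin k, ∀ u v : W, (M i).Adj u v →
    ∀ p : (⨆ j : {j : Fin k // j < i}, M j.1).Walk u v, s < p.length)

/-- `G` can be covered by `α` forests, i.e. `G` has arboricity at most `α`. -/
def HasForestCover {W : Type*} (G : SimpleGraph W) (α : ℕ) : Prop :=
  ∃ F : Fin α → SimpleGraph W, (∀ i, F i ≤ G) ∧ (∀ i, (F i).IsAcyclic) ∧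
    ∀ e ∈ G.edgeSet, ∃ i, e ∈ (F i).edgeSet

/-- A finite acyclic graph has at most as many edges as non-isolated vertices. -/
lemma acyclic_edges_le_support {W : Type*} [Fintype W] (F : SimpleGraph W) (hF : F.IsAcyclic) :
    F.edgeSet.ncard ≤ {v | ∃ w, F.Adj v w}.ncard := by
  classical
  set S : Set W := {v | ∃ w, F.Adj v w} with hS
  by_cases hne : Nonempty S
  · have hac : (F.induce S).IsAcyclic := hF.induce S
    obtain ⟨T, hFT, -, hT⟩ := (SimpleGraph.connected_top (V := S)).exists_isTree_le_of_le_of_isAcyclic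
      le_top hac
    have h1 := hT.card_edgeFinset
    have h2 : F.edgeSet ⊆ (Sym2.map Subtype.val) '' T.edgeSet := by
      intro e
      induction e using Sym2.ind with
      | _ x y =>
        intro he
        rw [SimpleGraph.mem_edgeSet] at he
        refine ⟨s(⟨x, y, he⟩, ⟨y, x, he.symm⟩), ?_, by simp⟩
        rw [SimpleGraph.mem_edgeSet]
        exact hFT (by simpa using he)
    have h3 := Set.ncard_le_ncard h2 (Set.toFinite _)
    have h4 := Set.ncard_image_le (f := Sym2.map (Subtype.val : S → W)) (Set.toFinite T.edgeSet)
    have h5 : T.edgeSet.ncard = T.edgeFinset.card := by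
      rw [← SimpleGraph.coe_edgeFinset, Set.ncard_coe_finset]
    have h6 : S.ncard = Fintype.card S := by
      rw [← Nat.card_coe_set_eq, Nat.card_eq_fintype_card]
    omega
  · have : F.edgeSet = ∅ := by
      ext e
      induction e using Sym2.ind with
      | _ x y =>
        simp only [SimpleGraph.mem_edgeSet, Set.mem_empty_iff_false, iff_false]
        intro he
        exact hne ⟨⟨x, y, he⟩⟩
    simp [this]

/-- Spanning star-forest: a subgraph with the same non-isolated vertices such that any walk of
length three collapses. -/
lemma exists_star_subgraph {W : Type*} [Fintype W] (F : SimpleGraph W) :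
    ∃ K ≤ F, (∀ v, (∃ w, F.Adj v w) → ∃ w, K.Adj v w) ∧
      ∀ a b c d, K.Adj a b → K.Adj b c → K.Adj c d → K.Adj a d := by
  classical
  have hfin : {K : SimpleGraph W | K ≤ F ∧ ∀ v, (∃ w, F.Adj v w) → ∃ w, K.Adj v w}.Finite :=
    Set.toFinite _
  obtain ⟨K, hK⟩ := hfin.exists_minimal ⟨F, le_rfl, fun v h => h⟩
  refine ⟨K, hK.prop.1, hK.prop.2, ?_⟩
  intro a b c d hab hbc hcd
  by_cases hac : a = c
  · subst hac; exact hcd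
  by_cases hbd : b = d
  · subst hbd; exact hab
  exfalso
  have hle : K.deleteEdges {s(b, c)} ≤ K := SimpleGraph.deleteEdges_le _
  have hmem : K.deleteEdges {s(b, c)} ≤ F ∧
      ∀ v, (∃ w, F.Adj v w) → ∃ w, (K.deleteEdges {s(b, c)}).Adj v w := by
    refine ⟨hle.trans hK.prop.1, fun v hv => ?_⟩
    obtain ⟨w, hw⟩ := hK.prop.2 v hv
    by_cases hvb : v = b
    · subst hvb
      refine ⟨a, ?_⟩
      rw [SimpleGraph.deleteEdges_adj]
      refine ⟨hab.symm, ?_⟩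
      have := hab.ne
      simp only [Set.mem_singleton_iff, Sym2.eq_iff]
      grind
    by_cases hvc : v = c
    · subst hvc
      refine ⟨d, ?_⟩
      rw [SimpleGraph.deleteEdges_adj]
      refine ⟨hcd, ?_⟩
      simp only [Set.mem_singleton_iff, Sym2.eq_iff]
      grind
    refine ⟨w, ?_⟩
    rw [SimpleGraph.deleteEdges_adj]
    refine ⟨hw, ?_⟩
    simp only [Set.mem_singleton_iff, Sym2.eq_iff]
    grind
  have := hK.le_of_le hmem hle
  have h2 := this hbc
  rw [SimpleGraph.deleteEdges_adj] at h2
  simp at h2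

/-- A permutation moving all the non-isolated vertices, each to distance one or two. -/
lemma exists_dispersal {W : Type*} [Fintype W] (F : SimpleGraph W) :
    ∃ σ : Equiv.Perm W, (∀ v, (∃ w, F.Adj v w) → σ v ≠ v) ∧
      ∀ v, σ v ≠ v → F.Adj v (σ v) ∨ ∃ c, F.Adj v c ∧ F.Adj c (σ v) := by
  classical
  obtain ⟨K, hKF, hsup, hstar⟩ := exists_star_subgraph F
  obtain ⟨σ, hσ, hmax⟩ := Finset.exists_max_image
    (Finset.univ.filter fun σ : Equiv.Perm W => ∀ v, K.Reachable v (σ v))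
    (fun σ => (Finset.univ.filter fun v => σ v ≠ v).card) ⟨1, by simp⟩
  simp only [Finset.mem_filter, Finset.mem_univ, true_and] at hσ hmax
  have hR : ∀ a d, K.Reachable a d → a = d ∨ K.Adj a d ∨ ∃ c, K.Adj a c ∧ K.Adj c d := by
    rintro a d ⟨p⟩
    induction p with
    | nil => exact Or.inl rfl
    | cons hadj p ih =>
      rcases ih with rfl | h | ⟨c, h1, h2⟩
      · exact Or.inr (Or.inl hadj)
      · exact Or.inr (Or.inr ⟨_, hadj, h⟩)
      · exact Or.inr (Or.inl (hstar _ _ _ _ hadj h1 h2))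
  refine ⟨σ, ?_, ?_⟩
  · intro v hv hfix
    obtain ⟨w, hw⟩ := hsup v hv
    have hne : v ≠ w := hw.ne
    have hlt := hmax (σ * Equiv.swap v w) (by
      intro x
      rw [Equiv.Perm.mul_apply]
      by_cases hxv : x = v
      · subst hxv
        rw [Equiv.swap_apply_left]
        exact hw.reachable.trans (hσ w)
      by_cases hxw : x = w
      · subst hxw
        rw [Equiv.swap_apply_right, hfix]
        exact hw.symm.reachable
      rw [Equiv.swap_apply_of_ne_of_ne hxv hxw]
      exact hσ x)
    refine absurd hlt (not_le.mpr (Finset.card_lt_card ?_))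
    rw [Finset.ssubset_iff_of_subset]
    · refine ⟨v, ?_, by simp [hfix]⟩
      simp only [Finset.mem_filter, Finset.mem_univ, true_and]
      rw [Equiv.Perm.mul_apply, Equiv.swap_apply_left]
      intro h
      exact hne (σ.injective (hfix.trans h.symm))
    · intro x
      simp only [Finset.mem_filter, Finset.mem_univ, true_and]
      rw [Equiv.Perm.mul_apply]
      intro hx
      have hxv : x ≠ v := by rintro rfl; exact hx hfix
      by_cases hxw : x = w
      · subst hxw
        rw [Equiv.swap_apply_right, hfix]
        exact hne
      rw [Equiv.swap_apply_of_ne_of_ne hxv hxw]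
      exact hx
  · intro v hv
    rcases hR v (σ v) (hσ v) with h | h | ⟨c, h1, h2⟩
    · exact absurd h.symm hv
    · exact Or.inl (hKF h)
    · exact Or.inr ⟨c, hKF h1, hKF h2⟩

/-- From two injective endpoint maps of arcs extract a matching with a third of the arcs. -/
lemma exists_matching {W T : Type*} [Fintype W] [Fintype T] (o i : T → W)
    (ho : Function.Injective o) (hi : Function.Injective i) (hoi : ∀ t, o t ≠ i t) :
    ∃ M : SimpleGraph W, (∀ x y, M.Adj x y → ∃ t, (x = o t ∧ y = i t) ∨ (x = i t ∧ y = o t)) ∧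
      (∀ v u w : W, M.Adj v u → M.Adj v w → u = w) ∧
      Fintype.card T ≤ 3 * M.edgeSet.ncard := by
  classical
  let P : Finset T → Prop := fun S => ∀ t ∈ S, ∀ t' ∈ S, t ≠ t' → o t ≠ i t'
  obtain ⟨S, hS, hmax⟩ := Finset.exists_max_image (Finset.univ.filter P) Finset.card
    ⟨∅, by simp [P]⟩
  simp only [Finset.mem_filter, Finset.mem_univ, true_and] at hS hmax
  have hcover : (Finset.univ : Finset T) ⊆ S ∪ (Finset.univ.filter fun t => o t ∈ S.image i) ∪
      (Finset.univ.filter fun t => i t ∈ S.image o) := by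
    intro t _
    by_contra hcon
    simp only [Finset.mem_union, Finset.mem_filter, Finset.mem_univ, true_and, not_or,
      Finset.mem_image, not_exists, not_and] at hcon
    obtain ⟨⟨h1, h2⟩, h3⟩ := hcon
    have := hmax (insert t S) (by
      intro a ha b hb hab
      rw [Finset.mem_insert] at ha hb
      rcases ha with rfl | ha <;> rcases hb with rfl | hb
      · exact absurd rfl hab
      · exact fun h => h2 b hb h.symm
      · exact h3 a ha
      · exact hS a ha b hb hab)
    rw [Finset.card_insert_of_notMem h1] at this
    omega
  have hc1 : (Finset.univ.filter fun t => o t ∈ S.image i).card ≤ S.card := by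
    refine (Finset.card_le_card_of_injOn o (by intro t; simp) ho.injOn).trans
      (Finset.card_image_le (s := S) (f := i))
  have hc2 : (Finset.univ.filter fun t => i t ∈ S.image o).card ≤ S.card := by
    refine (Finset.card_le_card_of_injOn i (by intro t; simp) hi.injOn).trans
      (Finset.card_image_le (s := S) (f := o))
  have hcard : Fintype.card T ≤ 3 * S.card := by
    have h1 := Finset.card_le_card hcover
    have h2 := Finset.card_union_le (S ∪ (Finset.univ.filter fun t => o t ∈ S.image i))
      (Finset.univ.filter fun t => i t ∈ S.image o)
    have h3 := Finset.card_union_le S (Finset.univ.filter fun t => o t ∈ S.image i)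
    rw [Finset.card_univ] at h1
    omega
  have hoi' : ∀ t ∈ S, ∀ t' ∈ S, o t ≠ i t' := by
    intro t ht t' ht'
    by_cases h : t = t'
    · subst h; exact hoi t
    · exact hS t ht t' ht' h
  let M : SimpleGraph W := SimpleGraph.fromEdgeSet ((fun t => s(o t, i t)) '' (S : Set T))
  have hadj : ∀ x y, M.Adj x y → ∃ t ∈ S, (x = o t ∧ y = i t) ∨ (x = i t ∧ y = o t) := by
    intro x y hxy
    rw [SimpleGraph.fromEdgeSet_adj] at hxy
    obtain ⟨⟨t, ht, he⟩, -⟩ := hxy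
    simp only [Sym2.eq_iff] at he
    exact ⟨t, ht, by grind⟩
  refine ⟨M, ?_, ?_, ?_⟩
  · intro x y hxy
    obtain ⟨t, -, h⟩ := hadj x y hxy
    exact ⟨t, h⟩
  · intro v u w hu hw
    obtain ⟨t, ht, h⟩ := hadj _ _ hu
    obtain ⟨t', ht', h'⟩ := hadj _ _ hw
    rcases h with ⟨a, b⟩ | ⟨a, b⟩ <;> rcases h' with ⟨a', b'⟩ | ⟨a', b'⟩
    · have : t = t' := ho (a.symm.trans a')
      rw [b, b', this]
    · exact absurd (a.symm.trans a') (hoi' t ht t' ht')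
    · exact absurd (a'.symm.trans a) (hoi' t' ht' t ht)
    · have : t = t' := hi (a.symm.trans a')
      rw [b, b', this]
  · refine hcard.trans (Nat.mul_le_mul_left 3 ?_)
    rw [← Set.ncard_coe_finset]
    refine Set.ncard_le_ncard_of_injOn (fun t => s(o t, i t)) ?_ ?_ (Set.toFinite _)
    · intro t ht
      rw [SimpleGraph.mem_edgeSet, SimpleGraph.fromEdgeSet_adj]
      exact ⟨⟨t, ht, rfl⟩, hoi t⟩
    · intro t ht t' ht' he
      simp only [Sym2.eq_iff] at he
      rcases he with h | h
      · exact ho h.1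
      · exact absurd h.1 (hoi' t ht t' ht')

lemma walkLen_append {G : SimpleGraph V} (ℓ : Sym2 V → ℝ) {u v w : V} (p : G.Walk u v)
    (q : G.Walk v w) : walkLen ℓ (p.append q) = walkLen ℓ p + walkLen ℓ q := by
  simp [walkLen]

lemma walkLen_reverse {G : SimpleGraph V} (ℓ : Sym2 V → ℝ) {u v : V} (p : G.Walk u v) :
    walkLen ℓ p.reverse = walkLen ℓ p := by
  simp [walkLen, List.sum_reverse]

lemma walkLen_mono {G : SimpleGraph V} {ℓ ℓ' : Sym2 V → ℝ} (hl : ∀ e, ℓ e ≤ ℓ' e) {u v : V}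
    (p : G.Walk u v) : walkLen ℓ p ≤ walkLen ℓ' p :=
  List.sum_le_sum fun e _ => hl e

lemma FarApart.mono {G : SimpleGraph V} {ℓ ℓ' : Sym2 V → ℝ} {h h' : ℝ} {u v : V}
    (hf : FarApart G ℓ h u v) (hl : ∀ e, ℓ e ≤ ℓ' e) (hh : h' ≤ h) : FarApart G ℓ' h' u v :=
  fun p => hh.trans_lt ((hf p).trans_le (walkLen_mono hl p))

lemma FarApart.symm {G : SimpleGraph V} {ℓ : Sym2 V → ℝ} {h : ℝ} {u v : V}
    (hf : FarApart G ℓ h u v) : FarApart G ℓ h v u :=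
  fun p => by rw [← walkLen_reverse]; exact hf p.reverse

/-- Lift an `A`-respecting demand without self-demand to a matching on copies. -/
lemma exists_lift [Fintype V] {W : Type*} [Fintype W] (A : V → ℕ) (D : V → V → ℕ)
    (hD : Respecting A D) (hdiag : ∀ v, D v v = 0) (e : (Σ v, Fin (A v)) ≃ W) :
    ∃ M : SimpleGraph W, (∀ x y, M.Adj x y →
        0 < D (e.symm x).1 (e.symm y).1 ∨ 0 < D (e.symm y).1 (e.symm x).1) ∧
      (∀ v u w : W, M.Adj v u → M.Adj v w → u = w) ∧
      ∑ u, ∑ v, D u v ≤ 3 * M.edgeSet.ncard := by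
  classical
  have h1 : ∀ u, Nonempty ((Σ v, Fin (D u v)) ↪ Fin (A u)) := fun u =>
    Function.Embedding.nonempty_of_card_le (by simpa using (hD u).1)
  have h2 : ∀ v, Nonempty ((Σ u, Fin (D u v)) ↪ Fin (A v)) := fun v =>
    Function.Embedding.nonempty_of_card_le (by simpa using (hD v).2)
  let f := fun u => (h1 u).some
  let g := fun v => (h2 v).some
  let o : (Σ u, Σ v, Fin (D u v)) → (Σ v, Fin (A v)) := fun t => ⟨t.1, f t.1 t.2⟩
  let i : (Σ u, Σ v, Fin (D u v)) → (Σ v, Fin (A v)) :=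
    fun t => ⟨t.2.1, g t.2.1 ⟨t.1, t.2.2⟩⟩
  have ho : Function.Injective o := by
    rintro ⟨u, t⟩ ⟨u', t'⟩ h
    obtain ⟨h1, h2⟩ := Sigma.mk.inj h
    dsimp only at h1
    subst h1
    have := (f u).injective (eq_of_heq h2)
    dsimp only at this
    rw [this]
  have hi : Function.Injective i := by
    rintro ⟨u, v, t⟩ ⟨u', v', t'⟩ h
    obtain ⟨h1, h2⟩ := Sigma.mk.inj h
    dsimp only at h1
    subst h1
    have := (g v).injective (eq_of_heq h2)
    obtain ⟨h3, h4⟩ := Sigma.mk.inj this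
    dsimp only at h3
    subst h3
    have h5 : t = t' := eq_of_heq h4
    rw [h5]
  have hpos : ∀ t : (Σ u, Σ v, Fin (D u v)), 0 < D t.1 t.2.1 := fun t => Fin.pos t.2.2
  obtain ⟨M, hM1, hM2, hM3⟩ := exists_matching (fun t => e (o t)) (fun t => e (i t))
    (e.injective.comp ho) (e.injective.comp hi) (by
      intro t h
      have := congrArg Sigma.fst (e.injective h)
      have h' : t.1 = t.2.1 := this
      have hp := hpos t
      rw [← h', hdiag] at hp
      exact lt_irrefl _ hp)
  refine ⟨M, ?_, hM2, ?_⟩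
  · intro x y hxy
    obtain ⟨t, ⟨rfl, rfl⟩ | ⟨rfl, rfl⟩⟩ := hM1 x y hxy
    · left
      simpa [o, i] using hpos t
    · right
      simpa [o, i] using hpos t
  · simpa using hM3

lemma demand_size_le [Fintype V] {A : V → ℕ} {D : V → V → ℕ} (hD : Respecting A D) :
    ∑ u, ∑ v, D u v ≤ ∑ v, A v :=
  Finset.sum_le_sum fun u _ => (hD u).1

lemma demandSize_bdd [Fintype V] (G : SimpleGraph V) (ℓ : Sym2 V → ℝ)
    (A : V → ℕ) (C : Sym2 V → ℝ) (h hs : ℝ) :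
    BddAbove {n | ∃ D : V → V → ℕ, Respecting A D ∧ HLength G ℓ h D ∧
    SeparatedDemand G ℓ hs C D ∧ n = ∑ u, ∑ v, D u v} := by
  refine ⟨∑ v, A v, ?_⟩
  rintro n ⟨D, hD, -, -, rfl⟩
  exact demand_size_le hD

lemma demandSize_mem [Fintype V] (G : SimpleGraph V) (ℓ : Sym2 V → ℝ)
    (A : V → ℕ) (C : Sym2 V → ℝ) (h hs : ℝ) :
    ∃ D : V → V → ℕ, Respecting A D ∧ HLength G ℓ h D ∧
    SeparatedDemand G ℓ hs C D ∧ demandSize G ℓ A C h hs = ∑ u, ∑ v, D u v := by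
  refine Nat.sSup_mem (s := {n | ∃ D : V → V → ℕ, Respecting A D ∧ HLength G ℓ h D ∧
    SeparatedDemand G ℓ hs C D ∧ n = ∑ u, ∑ v, D u v}) ?_ (demandSize_bdd G ℓ A C h hs)
  exact ⟨0, fun _ _ => 0, by intro v; simp, by intro u v; simp, by intro u v; simp, by simp⟩

/-- Push a permutation of the copies down to a demand. -/
lemma le_demandSize_of_perm [Fintype V] {W : Type*} [Fintype W] (G : SimpleGraph V)
    (ℓ : Sym2 V → ℝ) (A : V → ℕ) (C : Sym2 V → ℝ) (h hs : ℝ) (e : (Σ v, Fin (A v)) ≃ W)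
    (σ : Equiv.Perm W)
    (h1 : ∀ w, σ w ≠ w → ∃ p : G.Walk (e.symm w).1 (e.symm (σ w)).1, walkLen ℓ p ≤ h)
    (h2 : ∀ w, σ w ≠ w → FarApart G (fun e => ℓ e + hs * C e) hs (e.symm w).1 (e.symm (σ w)).1) :
    {w | σ w ≠ w}.ncard ≤ demandSize G ℓ A C h hs := by
  classical
  let D : V → V → ℕ := fun u v =>
    (Finset.univ.filter fun w => σ w ≠ w ∧ (e.symm w).1 = u ∧ (e.symm (σ w)).1 = v).card
  have hfib : ∀ u, (Finset.univ.filter fun w => (e.symm w).1 = u).card = A u := by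
    intro u
    have hinj : Function.Injective (fun i : Fin (A u) => e ⟨u, i⟩) := by
      intro i j hij
      simpa using hij
    have : (Finset.univ.filter fun w => (e.symm w).1 = u) =
        (Finset.univ : Finset (Fin (A u))).image (fun i => e ⟨u, i⟩) := by
      ext w
      simp only [Finset.mem_filter, Finset.mem_univ, true_and, Finset.mem_image]
      constructor
      · rintro rfl
        exact ⟨(e.symm w).2, by simp⟩
      · rintro ⟨i, rfl⟩
        simp
    rw [this, Finset.card_image_of_injective _ hinj]
    simp
  have hrow : ∀ u, ∑ v, D u v =
      (Finset.univ.filter fun w => σ w ≠ w ∧ (e.symm w).1 = u).card := by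
    intro u
    rw [Finset.card_eq_sum_card_fiberwise (f := fun w => (e.symm (σ w)).1) (t := Finset.univ)
      (by intro x _; simp)]
    refine Finset.sum_congr rfl fun v _ => ?_
    rw [Finset.filter_filter]
    simp only [D, and_assoc]
  have hcol : ∀ v, ∑ u, D u v =
      (Finset.univ.filter fun w => σ w ≠ w ∧ (e.symm (σ w)).1 = v).card := by
    intro v
    rw [Finset.card_eq_sum_card_fiberwise (f := fun w => (e.symm w).1) (t := Finset.univ)
      (by intro x _; simp)]
    refine Finset.sum_congr rfl fun u _ => ?_
    rw [Finset.filter_filter]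
    simp only [D]
    congr 1
    ext w
    simp only [Finset.mem_filter, Finset.mem_univ, true_and]
    tauto
  have hex : ∀ u v, 0 < D u v → ∃ w, σ w ≠ w ∧ (e.symm w).1 = u ∧ (e.symm (σ w)).1 = v := by
    intro u v hp
    obtain ⟨w, hw⟩ := Finset.card_pos.mp hp
    simp only [Finset.mem_filter, Finset.mem_univ, true_and] at hw
    exact ⟨w, hw⟩
  refine le_csSup (demandSize_bdd G ℓ A C h hs) ⟨D, ?_, ?_, ?_, ?_⟩
  · intro v
    constructor
    · rw [hrow, ← hfib v]
      refine Finset.card_le_card fun w => ?_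
      simp only [Finset.mem_filter, Finset.mem_univ, true_and]
      exact fun h => h.2
    · rw [hcol, ← hfib v]
      refine Finset.card_le_card_of_injOn σ ?_ σ.injective.injOn
      intro w
      simp only [Finset.coe_filter, Finset.mem_univ, true_and, Set.mem_ofPred_eq]
      exact fun h => h.2
  · intro u v hp
    obtain ⟨w, hw, rfl, rfl⟩ := hex u v hp
    exact h1 w hw
  · intro u v hp
    obtain ⟨w, hw, rfl, rfl⟩ := hex u v hp
    exact h2 w hw
  · simp only [hrow]
    rw [Set.ncard_eq_toFinset_card', Finset.card_eq_sum_card_fiberwise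
      (f := fun w => (e.symm w).1) (t := Finset.univ) (by intro x _; simp)]
    refine Finset.sum_congr rfl fun u _ => ?_
    congr 1
    ext w
    simp

/-- A walk in a graph all of whose edges are `h`-close projects to a walk of length at most `h`
times the number of edges. -/
lemma exists_walk_of_close {W : Type*} {H : SimpleGraph W} (G : SimpleGraph V) (ℓ : Sym2 V → ℝ)
    (h : ℝ) (π : W → V)
    (hcl : ∀ x y, H.Adj x y → ∃ p : G.Walk (π x) (π y), walkLen ℓ p ≤ h) {x y : W}
    (p : H.Walk x y) : ∃ q : G.Walk (π x) (π y), walkLen ℓ q ≤ h * p.length := by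
  induction p with
  | nil => exact ⟨SimpleGraph.Walk.nil, by simp [walkLen]⟩
  | cons hadj p ih =>
    obtain ⟨q, hq⟩ := ih
    obtain ⟨r, hr⟩ := hcl _ _ hadj
    refine ⟨r.append q, ?_⟩
    rw [walkLen_append, SimpleGraph.Walk.length_cons]
    push_cast
    linarith

/-- The combinatorial core. -/
lemma demand_core [Fintype V] (G : SimpleGraph V)
    (ℓ : Sym2 V → ℝ) (h : ℝ) (hh : 1 ≤ h) (s : ℕ) (hs : 2 ≤ s)
    (A : V → ℕ) (α : ℕ → ℕ)
    (hArb : ∀ (W : Type) [Fintype W] (Hg : SimpleGraph W) (k' : ℕ)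
      (M : Fin k' → SimpleGraph W),
      IsParallelGreedy Hg s k' M → HasForestCover Hg (α (Fintype.card W)))
    (k : ℕ) (C : Fin k → Sym2 V → ℝ) (hC : ∀ i e, 0 ≤ C i e) :
    ∑ i, demandSize G (fun e => ℓ e + h * s * ∑ j ∈ Finset.univ.filter (· < i), C j e)
        A (C i) h (h * s) ≤ 3 * (α (∑ v, A v) *
        demandSize G ℓ A (fun e => (1 + 1 / ((s : ℝ) - 1)) * ∑ i, C i e)
          (2 * h) (h * ((s : ℝ) - 1))) := by
  classical
  have hsR : (2 : ℝ) ≤ s := by exact_mod_cast hs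
  have hs0 : 0 ≤ h * s := by positivity
  set L : Fin k → Sym2 V → ℝ :=
    fun i e => ℓ e + h * s * ∑ j ∈ Finset.univ.filter (· < i), C j e with hL
  let L' : Fin k → Sym2 V → ℝ := fun i e => L i e + h * s * C i e
  let Lt : Sym2 V → ℝ := fun e => ℓ e + h * s * ∑ i, C i e
  have hL'eq : ∀ i e, L' i e = ℓ e + h * s * ∑ j ∈ Finset.univ.filter (· ≤ i), C j e := by
    intro i e
    have : (Finset.univ.filter (· ≤ i) : Finset (Fin k)) =
        insert i (Finset.univ.filter (· < i)) := by
      ext j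
      simp [le_iff_eq_or_lt]
    rw [this, Finset.sum_insert (by simp)]
    simp only [L', hL]
    ring
  have hLL : ∀ i j, i < j → ∀ e, L' i e ≤ L j e := by
    intro i j hij e
    rw [hL'eq]
    simp only [hL]
    refine add_le_add le_rfl (mul_le_mul_of_nonneg_left ?_ hs0)
    refine Finset.sum_le_sum_of_subset_of_nonneg ?_ fun x _ _ => hC x e
    intro x
    simp only [Finset.mem_filter, Finset.mem_univ, true_and]
    exact fun hx => hx.trans_lt hij
  have hL't : ∀ i e, L' i e ≤ Lt e := by
    intro i e
    rw [hL'eq]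
    simp only [Lt]
    refine add_le_add le_rfl (mul_le_mul_of_nonneg_left ?_ hs0)
    exact Finset.sum_le_sum_of_subset_of_nonneg (Finset.filter_subset _ _) fun x _ _ => hC x e
  have hLt : ∀ i e, L i e ≤ Lt e := fun i e =>
    (le_add_of_nonneg_right (mul_nonneg hs0 (hC i e))).trans (hL't i e)
  have hℓL : ∀ i e, ℓ e ≤ L i e := fun i e =>
    le_add_of_nonneg_right (mul_nonneg hs0 (Finset.sum_nonneg fun j _ => hC j e))
  choose D hD1 hD2 hD3 hD4 using fun i => demandSize_mem G (L i) A (C i) h (h * s)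
  have hdiag : ∀ i v, D i v v = 0 := by
    intro i v
    by_contra hne
    have := hD3 i v v (Nat.pos_of_ne_zero hne) SimpleGraph.Walk.nil
    simp [walkLen] at this
    nlinarith
  let e : (Σ v, Fin (A v)) ≃ Fin (∑ v, A v) :=
    Fintype.equivFinOfCardEq (by simp)
  let π : Fin (∑ v, A v) → V := fun w => (e.symm w).1
  choose M hM1 hM2 hM3 using fun i => exists_lift A (D i) (hD1 i) (hdiag i) e
  have hnear : ∀ i x y, (M i).Adj x y → ∃ p : G.Walk (π x) (π y), walkLen (L i) p ≤ h := by
    intro i x y hxy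
    rcases hM1 i x y hxy with hp | hp
    · exact hD2 i _ _ hp
    · obtain ⟨p, hp⟩ := hD2 i _ _ hp
      exact ⟨p.reverse, by rw [walkLen_reverse]; exact hp⟩
  have hfar : ∀ i x y, (M i).Adj x y → FarApart G (L' i) (h * s) (π x) (π y) := by
    intro i x y hxy
    rcases hM1 i x y hxy with hp | hp
    · exact hD3 i _ _ hp
    · exact (hD3 i _ _ hp).symm
  have hdisj : ∀ i j, i < j → ∀ x y, (M i).Adj x y → (M j).Adj x y → False := by
    intro i j hij x y h1 h2
    obtain ⟨p, hp⟩ := hnear j x y h2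
    have h3 := hfar i x y h1 p
    have h4 := walkLen_mono (hLL i j hij) p
    nlinarith
  have hdisj' : ∀ i j, i ≠ j → Disjoint (M i).edgeSet (M j).edgeSet := by
    intro i j hij
    rw [Set.disjoint_left]
    intro a
    induction a using Sym2.ind with
    | _ x y =>
      rw [SimpleGraph.mem_edgeSet, SimpleGraph.mem_edgeSet]
      intro h1 h2
      rcases lt_or_gt_of_ne hij with h | h
      · exact hdisj i j h x y h1 h2
      · exact hdisj j i h x y h2 h1
  have hgreedy : IsParallelGreedy (⨆ i, M i) s k (fun i => M i.rev) := by
    refine ⟨fun i => le_iSup M i.rev, ?_, ?_, fun i => hM2 i.rev, ?_⟩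
    · intro a
      induction a using Sym2.ind with
      | _ x y =>
        simp only [SimpleGraph.mem_edgeSet, SimpleGraph.iSup_adj]
        rintro ⟨i, hi⟩
        exact ⟨i.rev, by simpa using hi⟩
    · intro i j hij
      exact hdisj' _ _ (fun h => hij (Fin.rev_injective h))
    · intro i u v huv p
      have hcl : ∀ x y, (⨆ j : {j : Fin k // j < i}, M j.1.rev).Adj x y →
          ∃ p : G.Walk (π x) (π y), walkLen (L' i.rev) p ≤ h := by
        intro x y hxy
        rw [SimpleGraph.iSup_adj] at hxy
        obtain ⟨⟨j, hj⟩, hxy⟩ := hxy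
        obtain ⟨q, hq⟩ := hnear _ x y hxy
        exact ⟨q, (walkLen_mono (hLL _ _ (Fin.rev_lt_rev.mpr hj)) q).trans hq⟩
      obtain ⟨q, hq⟩ := exists_walk_of_close G (L' i.rev) h π hcl p
      have h1 := hfar _ u v huv q
      have h2 : h * s < h * p.length := h1.trans_le hq
      exact_mod_cast lt_of_mul_lt_mul_left h2 (by linarith)
  have hcover := hArb (Fin (∑ v, A v)) _ k _ hgreedy
  rw [Fintype.card_fin] at hcover
  obtain ⟨F, hF1, hF2, hF3⟩ := hcover
  have hFd : ∀ j, (F j).edgeSet.ncard ≤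
      demandSize G ℓ A (fun e => (1 + 1 / ((s : ℝ) - 1)) * ∑ i, C i e)
          (2 * h) (h * ((s : ℝ) - 1)) := by
    intro j
    obtain ⟨σ, hσ1, hσ2⟩ := exists_dispersal (F j)
    refine (acyclic_edges_le_support (F j) (hF2 j)).trans
      ((Set.ncard_le_ncard (t := {w | σ w ≠ w}) hσ1 (Set.toFinite _)).trans ?_)
    have hadj : ∀ x y, (F j).Adj x y → ∃ i, (M i).Adj x y := by
      intro x y hxy
      have := hF1 j hxy
      rwa [SimpleGraph.iSup_adj] at this
    have hLteq : (fun e => ℓ e + h * ((s : ℝ) - 1) *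
        ((1 + 1 / ((s : ℝ) - 1)) * ∑ i, C i e)) = Lt := by
      funext e
      have : (s : ℝ) - 1 ≠ 0 := by linarith
      simp only [Lt]
      field_simp
      ring
    refine le_demandSize_of_perm G ℓ A _ _ _ e σ ?_ ?_
    · intro w hw
      have hn : ∀ x y, (F j).Adj x y → ∃ p : G.Walk (π x) (π y), walkLen ℓ p ≤ h := by
        intro x y hxy
        obtain ⟨i, hi⟩ := hadj x y hxy
        obtain ⟨p, hp⟩ := hnear i x y hi
        exact ⟨p, (walkLen_mono (hℓL i) p).trans hp⟩
      rcases hσ2 w hw with h1 | ⟨c, h1, h2⟩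
      · obtain ⟨p, hp⟩ := hn _ _ h1
        exact ⟨p, by linarith⟩
      · obtain ⟨p, hp⟩ := hn _ _ h1
        obtain ⟨q, hq⟩ := hn _ _ h2
        exact ⟨p.append q, by rw [walkLen_append]; linarith⟩
    · intro w hw
      rw [hLteq]
      have key : ∀ i i', i < i' → ∀ x c y, (M i).Adj x c → (M i').Adj c y →
          FarApart G Lt (h * ((s : ℝ) - 1)) (π x) (π y) := by
        intro i i' hii x c y h1 h2 p
        obtain ⟨q, hq⟩ := hnear i' y c h2.symm
        have h3 := hfar i x c h1 (p.append q)
        rw [walkLen_append] at h3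
        have h4 := walkLen_mono (hL't i) p
        have h5 := walkLen_mono (hLL i i' hii) q
        linarith
      rcases hσ2 w hw with h1 | ⟨c, h1, h2⟩
      · obtain ⟨i, hi⟩ := hadj _ _ h1
        exact (hfar i _ _ hi).mono (hL't i) (by linarith)
      · obtain ⟨i, hi⟩ := hadj _ _ h1
        obtain ⟨i', hi'⟩ := hadj _ _ h2
        rcases lt_trichotomy i i' with hlt | rfl | hlt
        · exact key i i' hlt _ _ _ hi hi'
        · exact absurd (hM2 i c _ _ hi.symm hi').symm hw
        · exact (key i' i hlt _ _ _ hi'.symm hi.symm).symm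
  calc ∑ i, demandSize G (L i) A (C i) h (h * s)
      ≤ ∑ i, 3 * (M i).edgeSet.ncard := Finset.sum_le_sum fun i _ => by
        rw [hD4]; exact hM3 i
    _ = 3 * ∑ i, (M i).edgeSet.ncard := by rw [Finset.mul_sum]
    _ ≤ _ := by
      refine Nat.mul_le_mul_left 3 ?_
      have h1 : ∑ i, (M i).edgeSet.ncard =
          (Finset.univ.biUnion fun i => (M i).edgeFinset).card := by
        rw [Finset.card_biUnion]
        · refine Finset.sum_congr rfl fun i _ => ?_
          rw [← SimpleGraph.coe_edgeFinset, Set.ncard_coe_finset]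
        · intro i _ j _ hij
          exact SimpleGraph.disjoint_edgeFinset.mpr (SimpleGraph.disjoint_edgeSet.mp (hdisj' i j hij))
      have h2 : (Finset.univ.biUnion fun i => (M i).edgeFinset) ⊆
          (Finset.univ.biUnion fun j => (F j).edgeFinset) := by
        intro a ha
        simp only [Finset.mem_biUnion, Finset.mem_univ, true_and,
          SimpleGraph.mem_edgeFinset] at ha ⊢
        obtain ⟨i, hi⟩ := ha
        exact hF3 a (SimpleGraph.edgeSet_mono (le_iSup M i) hi)
      rw [h1]
      refine (Finset.card_le_card h2).trans (Finset.card_biUnion_le.trans ?_)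
      refine (Finset.sum_le_sum (g := fun _ => demandSize G ℓ A
        (fun e => (1 + 1 / ((s : ℝ) - 1)) * ∑ i, C i e)
          (2 * h) (h * ((s : ℝ) - 1))) fun j _ => ?_).trans (by simp)
      refine le_trans (le_of_eq ?_) (hFd j)
      rw [← SimpleGraph.coe_edgeFinset, Set.ncard_coe_finset]

/-- Union of sparse length-constrained cuts. Suppose every `n`-node `s`-parallel-greedy
graph has arboricity at most `α n`. Let `(C_1, …, C_k)` be length-constrained cuts in a
graph `G` with edge lengths `ℓ` and capacities `cap`, and let `A` be a node-weighting.
Then `C = (1 + 1/(s−1))·Σ_i C_i` is a `(2h, (s−1)/2)`-length `φ'`-sparse cut with respect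
to `A`, where `φ' = 8·α(|A|)·(Σ_i |C_i|) / (Σ_i A_{(h,s)}(C_i))` and `A_{(h,s)}(C_i)` is
the `(h,s)`-length demand-size of `C_i` in `G − (Σ_{j<i} C_j)_{hs}`. (Being
`(2h,(s−1)/2)`-length `φ'`-sparse means `|C| ≤ φ'·A_{(2h,(s-1)/2)}(C)`, where the
`(2h,(s−1)/2)`-length demand-size is that of `2h`-length demands separated at scale
`2h·(s−1)/2 = h(s−1)`.) -/
theorem union_of_sparse_cuts
    [Fintype V] [DecidableEq V] (G : SimpleGraph V) [DecidableRel G.Adj]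
    (ℓ : Sym2 V → ℝ) (hℓ : ∀ e, 0 ≤ ℓ e) (cap : Sym2 V → ℕ)
    (h : ℝ) (hh : 1 ≤ h) (s : ℕ) (hs : 2 ≤ s)
    (A : V → ℕ) (hA : ∀ v, A v ≤ G.degree v)
    (α : ℕ → ℕ)
    (hArb : ∀ (W : Type) [Fintype W] (Hg : SimpleGraph W) (k' : ℕ)
      (M : Fin k' → SimpleGraph W),
      IsParallelGreedy Hg s k' M → HasForestCover Hg (α (Fintype.card W)))
    (k : ℕ) (C : Fin k → Sym2 V → ℝ) (hC : ∀ i e, 0 ≤ C i e)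
    (hpos : 0 < ∑ i,
      demandSize G (fun e => ℓ e + h * s * ∑ j ∈ Finset.univ.filter (· < i), C j e)
        A (C i) h (h * s)) :
    cutSize G cap (fun e => (1 + 1 / ((s : ℝ) - 1)) * ∑ i, C i e) ≤
      (8 * (α (∑ v, A v) : ℝ) * (∑ i, cutSize G cap (C i)) /
          ∑ i, (demandSize G
            (fun e => ℓ e + h * s * ∑ j ∈ Finset.univ.filter (· < i), C j e)
            A (C i) h (h * s) : ℝ)) *
        (demandSize G ℓ A (fun e => (1 + 1 / ((s : ℝ) - 1)) * ∑ i, C i e)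
          (2 * h) (h * ((s : ℝ) - 1)) : ℝ) := by
  have hcore := demand_core G ℓ h hh s hs A α hArb k C hC
  have hsR : (2 : ℝ) ≤ s := by exact_mod_cast hs
  have hcut : cutSize G cap (fun e => (1 + 1 / ((s : ℝ) - 1)) * ∑ i, C i e) =
      (1 + 1 / ((s : ℝ) - 1)) * ∑ i, cutSize G cap (C i) := by
    simp only [cutSize]
    rw [Finset.sum_comm, Finset.mul_sum]
    refine Finset.sum_congr rfl fun e _ => ?_
    rw [← Finset.mul_sum]
    ring
  have hnn : 0 ≤ ∑ i, cutSize G cap (C i) :=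
    Finset.sum_nonneg fun i _ => Finset.sum_nonneg fun e _ => mul_nonneg (Nat.cast_nonneg _) (hC i e)
  have hfac : 1 + 1 / ((s : ℝ) - 1) ≤ 2 := by
    have : 1 / ((s : ℝ) - 1) ≤ 1 := by
      rw [div_le_one (by linarith)]
      linarith
    linarith
  rw [hcut]
  generalize demandSize G ℓ A (fun e => (1 + 1 / ((s : ℝ) - 1)) * ∑ i, C i e)
          (2 * h) (h * ((s : ℝ) - 1)) = d at hcore ⊢
  rw [← Nat.cast_sum]
  generalize ∑ i, demandSize G
    (fun e => ℓ e + h * s * ∑ j ∈ Finset.univ.filter (· < i), C j e)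
        A (C i) h (h * s) = S at hcore hpos ⊢
  generalize ∑ i, cutSize G cap (C i) = X at hnn ⊢
  have hS : (0 : ℝ) < S := by exact_mod_cast hpos
  have hcoreR : (S : ℝ) ≤ 3 * ((α (∑ v, A v) : ℝ) * d) := by exact_mod_cast hcore
  rw [div_mul_eq_mul_div, le_div_iff₀ hS]
  calc (1 + 1 / ((s : ℝ) - 1)) * X * S ≤ 2 * X * S := by gcongr
    _ ≤ 2 * X * (3 * ((α (∑ v, A v) : ℝ) * d)) := by gcongr
    _ ≤ 8 * (α (∑ v, A v) : ℝ) * X * d := by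
      have : 0 ≤ (α (∑ v, A v) : ℝ) * d * X := by positivity
      nlinarith
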